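/- arXiv:2007.06808 — 3 statements merged into one kernel-verified Lean document; each statement's English description precedes it below -/
import Mathlib

section
/- Let n ≥ 1, let S be a measurable function from the unit sphere S^{n-1} in ℝ^n to the nonnegative reals, and let h : ℝ^n → ℝ be an integrable function on the star-shaped body D = {x ∈ ℝ^n \ {0} : ‖x‖ ≤ S(x/‖x‖)}. Then ∫_D h(x) dx = ∫_{S^{n-1}} (∫_0^{S(ŝ)} ρ^{n-1} h(ρ ŝ) dρ) dσ(ŝ), where σ is the (n−1)-dimensional surface measure on the unit sphere (with total mass s_n). -/
open MeasureTheory Metric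

/-- Integration in polar coordinates with respect to an additive Haar measure. -/
theorem integral_eq_integral_toSphere_integral_Ioi {E F : Type*}
    [NormedAddCommGroup E] [NormedSpace ℝ E] [FiniteDimensional ℝ E] [Nontrivial E]
    [MeasurableSpace E] [BorelSpace E] [NormedAddCommGroup F] [NormedSpace ℝ F]
    (μ : Measure E) [μ.IsAddHaarMeasure] {f : E → F} (hf : Integrable f μ) :
    ∫ x, f x ∂μ = ∫ s : sphere (0 : E) 1,
      (∫ r in Set.Ioi (0 : ℝ), r ^ (Module.finrank ℝ E - 1) • f (r • (s : E))) ∂μ.toSphere := by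
  have hmp := μ.measurePreserving_homeomorphUnitSphereProd
  have hemb := (homeomorphUnitSphereProd E).measurableEmbedding
  have hcomp : (fun x : ({0}ᶜ : Set E) ↦ f x) =
      (fun p : sphere (0 : E) 1 × Set.Ioi (0 : ℝ) ↦ f ((p.2 : ℝ) • (p.1 : E))) ∘
        homeomorphUnitSphereProd E := by
    funext x
    have hx : (x : E) ≠ 0 := x.2
    simp [smul_smul, hx]
  have hint : Integrable (fun p : sphere (0 : E) 1 × Set.Ioi (0 : ℝ) ↦ f ((p.2 : ℝ) • (p.1 : E)))
      (μ.toSphere.prod (.volumeIoiPow (Module.finrank ℝ E - 1))) := by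
    rw [← hmp.integrable_comp_emb hemb, ← hcomp]
    exact (integrableOn_iff_comap_subtypeVal (measurableSet_singleton _).compl).1 hf.integrableOn
  calc
    ∫ x, f x ∂μ = ∫ x : ({0}ᶜ : Set E), f x ∂(μ.comap (↑)) := by
      rw [integral_subtype_comap (measurableSet_singleton _).compl f, restrict_compl_singleton]
    _ = ∫ p : sphere (0 : E) 1 × Set.Ioi (0 : ℝ), f ((p.2 : ℝ) • (p.1 : E))
        ∂μ.toSphere.prod (.volumeIoiPow (Module.finrank ℝ E - 1)) := by
      rw [hcomp]
      exact hmp.integral_comp hemb fun p ↦ f ((p.2 : ℝ) • (p.1 : E))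
    _ = ∫ s : sphere (0 : E) 1, ∫ r : Set.Ioi (0 : ℝ), f ((r : ℝ) • (s : E))
        ∂.volumeIoiPow (Module.finrank ℝ E - 1) ∂μ.toSphere := integral_prod _ hint
    _ = _ := by
      congr 1 with s
      simp only [Measure.volumeIoiPow, ENNReal.ofReal]
      rw [integral_withDensity_eq_integral_smul,
        integral_subtype_comap measurableSet_Ioi
          fun a ↦ Real.toNNReal (a ^ (Module.finrank ℝ E - 1)) • f (a • (s : E)),
        setIntegral_congr_fun measurableSet_Ioi fun x hx ↦ ?_]
      · rw [NNReal.smul_def, Real.coe_toNNReal _ (pow_nonneg hx.out.le _)]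
      · exact (measurable_subtype_coe.pow_const _).real_toNNReal

/-- **Integral over a star-shaped domain via extents.** For `n ≥ 1`, a measurable nonnegative
extent function `S` on the unit sphere in `ℝ^n`, and a function `h` integrable on the
star-shaped body `D = {x ≠ 0 : ‖x‖ ≤ S(x/‖x‖)}`, the integral of `h` over `D` equals
`∫_{S^{n-1}} (∫_0^{S(ŝ)} ρ^{n-1} h(ρ ŝ) dρ) dσ(ŝ)`, where `σ` is the surface measure on the
unit sphere. -/
theorem integral_starShaped_eq_integral_sphere_radial
    (n : ℕ) (hn : 1 ≤ n)
    (S : EuclideanSpace ℝ (Fin n) → ℝ)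
    (hS : Measurable S) (hS0 : ∀ x, 0 ≤ S x)
    (h : EuclideanSpace ℝ (Fin n) → ℝ)
    (hh : IntegrableOn h {x : EuclideanSpace ℝ (Fin n) | x ≠ 0 ∧ ‖x‖ ≤ S (‖x‖⁻¹ • x)}) :
    ∫ x in {x : EuclideanSpace ℝ (Fin n) | x ≠ 0 ∧ ‖x‖ ≤ S (‖x‖⁻¹ • x)}, h x =
      ∫ s : sphere (0 : EuclideanSpace ℝ (Fin n)) 1,
        (∫ ρ in (0 : ℝ)..(S (s : EuclideanSpace ℝ (Fin n))),
          ρ ^ (n - 1) * h (ρ • (s : EuclideanSpace ℝ (Fin n)))) ∂(volume.toSphere) := by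
  have : Nontrivial (EuclideanSpace ℝ (Fin n)) :=
    Module.nontrivial_of_finrank_pos (R := ℝ) (by rw [finrank_euclideanSpace_fin]; omega)
  set D := {x : EuclideanSpace ℝ (Fin n) | x ≠ 0 ∧ ‖x‖ ≤ S (‖x‖⁻¹ • x)} with hD
  have hDm : MeasurableSet D :=
    (measurableSet_singleton _).compl.inter
      (measurableSet_le measurable_norm (hS.comp (measurable_norm.inv.smul measurable_id)))
  rw [← integral_indicator hDm,
    integral_eq_integral_toSphere_integral_Ioi _ ((integrable_indicator_iff hDm).2 hh),
    finrank_euclideanSpace_fin]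
  congr 1 with s
  rw [intervalIntegral.integral_of_le (hS0 _), ← Set.Ioi_inter_Iic, Set.inter_comm,
    ← Measure.restrict_restrict measurableSet_Iic, ← integral_indicator measurableSet_Iic]
  refine setIntegral_congr_fun measurableSet_Ioi fun r (hr : 0 < r) ↦ ?_
  have hs : ‖(s : EuclideanSpace ℝ (Fin n))‖ = 1 := norm_eq_of_mem_sphere s
  have hs0 : (s : EuclideanSpace ℝ (Fin n)) ≠ 0 := ne_zero_of_mem_unit_sphere s
  have hmem : r • (s : EuclideanSpace ℝ (Fin n)) ∈ D ↔ r ∈ Set.Iic (S s) := by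
    simp [hD, norm_smul, hs, hr.ne', hs0, abs_of_pos hr, smul_smul]
  by_cases hrS : r ∈ Set.Iic (S s)
  · simp only [Set.indicator_of_mem hrS, Set.indicator_of_mem (hmem.2 hrS), smul_eq_mul]
  · simp only [Set.indicator_of_notMem hrS, Set.indicator_of_notMem (mt hmem.1 hrS), smul_zero]
end

section
/- Let λ > 1 and let X be a real-valued random variable whose law has a density f supported on the interval [1/λ, 1], with f_max ≥ f(x) ≥ f_min > 0 for all x ∈ [1/λ, 1]. Then there exist a constant c ∈ ℝ and a natural number k₀ such that for all natural numbers k ≥ k₀, √Var(X^k) / E[X^k] ≤ c·√k. -/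
open MeasureTheory ProbabilityTheory

/-- The `n`-th moment of a random variable with density `f` supported on `[a, 1]`. -/
lemma integral_pow_eq_intervalIntegral_of_density
    {Ω : Type*} [MeasurableSpace Ω] {μ : Measure Ω} {X : Ω → ℝ} (hX : Measurable X)
    {f : ℝ → ℝ} (hf : Measurable f) (hf0 : ∀ x, 0 ≤ f x)
    (hlaw : μ.map X = volume.withDensity fun x => ENNReal.ofReal (f x))
    {a : ℝ} (ha : a ≤ 1) (hsupp : ∀ x ∉ Set.Icc a 1, f x = 0) (n : ℕ) :
    ∫ ω, X ω ^ n ∂μ = ∫ x in a..1, f x * x ^ n := by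
  have hmap : ∫ ω, X ω ^ n ∂μ = ∫ x, x ^ n ∂(μ.map X) :=
    (integral_map hX.aemeasurable (continuous_pow n).aestronglyMeasurable).symm
  rw [hmap, hlaw, integral_withDensity_eq_integral_toReal_smul (by fun_prop) (by simp),
    intervalIntegral.integral_of_le ha, ← integral_Icc_eq_integral_Ioc,
    setIntegral_eq_integral_of_forall_compl_eq_zero]
  · simp [ENNReal.toReal_ofReal (hf0 _)]
  · intro x hx
    simp [hsupp x hx]

/-- Two-sided bounds for the moments of a density pinched between two constants. -/
lemma intervalIntegral_mul_pow_bounds {f : ℝ → ℝ} (hf : Measurable f) {a m M : ℝ}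
    (ha0 : 0 ≤ a) (ha : a ≤ 1) (hm : 0 ≤ m)
    (hbounds : ∀ x ∈ Set.Icc a 1, m ≤ f x ∧ f x ≤ M) (n : ℕ) :
    m * ((1 - a ^ (n + 1)) / (n + 1)) ≤ ∫ x in a..1, f x * x ^ n ∧
      ∫ x in a..1, f x * x ^ n ≤ M * ((1 - a ^ (n + 1)) / (n + 1)) := by
  have hconst (c : ℝ) : IntervalIntegrable (fun x => c * x ^ n) volume a 1 :=
    Continuous.intervalIntegrable (by fun_prop) _ _
  have heval (c : ℝ) : ∫ x in a..1, c * x ^ n = c * ((1 - a ^ (n + 1)) / (n + 1)) := by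
    simp
  have hint : IntervalIntegrable (fun x => f x * x ^ n) volume a 1 := by
    refine (hconst M).mono_fun' (by fun_prop) ?_
    filter_upwards [ae_restrict_mem measurableSet_uIoc] with x hx
    rw [Set.uIoc_of_le ha] at hx
    have hb := hbounds x ⟨hx.1.le, hx.2⟩
    have hx0 : 0 ≤ x := ha0.trans hx.1.le
    rw [Real.norm_of_nonneg (mul_nonneg (hm.trans hb.1) (pow_nonneg hx0 n))]
    exact mul_le_mul_of_nonneg_right hb.2 (pow_nonneg hx0 n)
  rw [← heval, ← heval]
  exact ⟨intervalIntegral.integral_mono_on ha (hconst m) hint fun x hx =>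
      mul_le_mul_of_nonneg_right (hbounds x hx).1 (pow_nonneg (ha0.trans hx.1) n),
    intervalIntegral.integral_mono_on ha hint (hconst M) fun x hx =>
      mul_le_mul_of_nonneg_right (hbounds x hx).2 (pow_nonneg (ha0.trans hx.1) n)⟩

/-- **Theorem 4.2.** If `X` is a random variable whose law has density `f` supported on
`[1/λ, 1]` with `f_max ≥ f(x) ≥ f_min > 0` there, then there exist `c ∈ ℝ` and `k₀ ∈ ℕ` such
that for all `k ≥ k₀`, `√Var(X^k) / E[X^k] ≤ c·√k`. -/
theorem sqrt_variance_div_mean_le_sqrt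
    {Ω : Type*} [MeasurableSpace Ω] (μ : Measure Ω) [IsProbabilityMeasure μ]
    (lam : ℝ) (hlam : 1 < lam)
    (X : Ω → ℝ) (hX : Measurable X)
    (f : ℝ → ℝ) (hf : Measurable f)
    (hlaw : μ.map X = volume.withDensity fun x => ENNReal.ofReal (f x))
    (hsupp : ∀ x ∉ Set.Icc (1 / lam) 1, f x = 0)
    (fmin fmax : ℝ) (hfmin : 0 < fmin)
    (hbounds : ∀ x ∈ Set.Icc (1 / lam) 1, fmin ≤ f x ∧ f x ≤ fmax) :
    ∃ (c : ℝ) (k₀ : ℕ), ∀ k : ℕ, k₀ ≤ k →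
      Real.sqrt (variance (fun ω => X ω ^ k) μ) / ∫ ω, X ω ^ k ∂μ ≤
        c * Real.sqrt k := by
  have ha0 : 0 < 1 / lam := by positivity
  have ha1 : 1 / lam < 1 := by rw [div_lt_one (by linarith)]; exact hlam
  generalize 1 / lam = a at *
  have hfmax : 0 ≤ fmax := by
    have := hbounds 1 ⟨ha1.le, le_rfl⟩
    linarith
  have hf0 (x : ℝ) : 0 ≤ f x := by
    by_cases hx : x ∈ Set.Icc a 1
    · exact hfmin.le.trans (hbounds x hx).1
    · exact (hsupp x hx).ge
  have hmom := integral_pow_eq_intervalIntegral_of_density hX hf hf0 hlaw ha1.le hsupp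
  have hbd := intervalIntegral_mul_pow_bounds hf ha0.le ha1.le hfmin.le hbounds
  have h1a : 0 < 1 - a := sub_pos.2 ha1
  refine ⟨2 * Real.sqrt fmax / (fmin * (1 - a)), 1, fun k hk => ?_⟩
  have hk1 : (1 : ℝ) ≤ k := by exact_mod_cast hk
  have hk0 : (0 : ℝ) < k := by linarith
  have hmean : fmin * (1 - a) / (2 * k) ≤ ∫ ω, X ω ^ k ∂μ := by
    rw [hmom, mul_div_assoc]
    refine le_trans (mul_le_mul_of_nonneg_left ?_ hfmin.le) (hbd k).1
    have hpow : a ^ (k + 1) ≤ a := pow_le_of_le_one ha0.le ha1.le (Nat.succ_ne_zero k)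
    exact div_le_div₀ (by linarith) (by linarith) (by linarith) (by linarith)
  have hvar : variance (fun ω => X ω ^ k) μ ≤ fmax / k := by
    refine (variance_le_expectation_sq (by fun_prop)).trans ?_
    have hsq : μ[(fun ω => X ω ^ k) ^ 2] = ∫ ω, X ω ^ (k * 2) ∂μ := by
      simp [pow_mul]
    rw [hsq, hmom, div_eq_mul_one_div]
    refine (hbd (k * 2)).2.trans (mul_le_mul_of_nonneg_left ?_ hfmax)
    have hpow : 0 ≤ a ^ (k * 2 + 1) := by positivity
    exact div_le_div₀ zero_le_one (by linarith) hk0 (by push_cast; linarith)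
  calc Real.sqrt (variance (fun ω => X ω ^ k) μ) / ∫ ω, X ω ^ k ∂μ
      ≤ Real.sqrt (fmax / k) / (fmin * (1 - a) / (2 * k)) :=
        div_le_div₀ (Real.sqrt_nonneg _) (Real.sqrt_le_sqrt hvar) (by positivity) hmean
    _ = 2 * Real.sqrt fmax / (fmin * (1 - a)) * Real.sqrt k := by
        have hs : Real.sqrt k ≠ 0 := (Real.sqrt_pos.2 hk0).ne'
        have hss : Real.sqrt k ^ 2 = k := Real.sq_sqrt hk0.le
        rw [Real.sqrt_div hfmax]
        field_simp
        rw [hss]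
end

section
/- Let λ > 1, let X be a real-valued random variable whose law has a density f supported on [1/λ, 1] with f_max ≥ f(x) ≥ f_min > 0 on that interval, let n ≥ 1 be a natural number, and let ε > 0. If N is a natural number with N ≥ (f_max/f_min²)·((n+1)²/(2n+1))·((1 − 1/λ^{2n+1})/(1 − 1/λ^{n+1})²)·(1/ε²), then the relative RMS error satisfies (√Var(X^n)/E[X^n])·(1/√N) ≤ ε. In particular, for a given extent density and relative RMS error ε, the required number of samples N grows at most linearly with the dimension n. -/
open MeasureTheory ProbabilityTheory

/-- If the law of `X` has a density supported on `[a, b]`, the expectation of `X ^ k` is the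
`k`-th moment of the density. -/
theorem integral_pow_eq_intervalIntegral_density
    {Ω : Type*} [MeasurableSpace Ω] {μ : Measure Ω} {a b : ℝ} (hab : a ≤ b)
    {X : Ω → ℝ} (hX : Measurable X) {f : ℝ → ℝ} (hf : Measurable f) (hf0 : ∀ x, 0 ≤ f x)
    (hlaw : μ.map X = volume.withDensity fun x => ENNReal.ofReal (f x))
    (hsupp : ∀ x ∉ Set.Icc a b, f x = 0) (k : ℕ) :
    ∫ ω, X ω ^ k ∂μ = ∫ x in a..b, f x * x ^ k := by
  rw [← integral_map (f := fun x : ℝ => x ^ k) hX.aemeasurable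
      (by fun_prop : Continuous fun x : ℝ => x ^ k).aestronglyMeasurable, hlaw,
    integral_withDensity_eq_integral_toReal_smul hf.ennreal_ofReal (by simp),
    intervalIntegral.integral_of_le hab, ← integral_Icc_eq_integral_Ioc,
    setIntegral_eq_integral_of_forall_compl_eq_zero fun x hx => by simp [hsupp x hx]]
  simp [ENNReal.toReal_ofReal, hf0]

/-- Pointwise bounds on a density over `[a, b]` give bounds on its moments. -/
theorem intervalIntegral_density_mul_pow_bounds {a b : ℝ} (ha : 0 ≤ a) (hab : a ≤ b)
    {f : ℝ → ℝ} (hf : Measurable f) {c C : ℝ}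
    (hbounds : ∀ x ∈ Set.Icc a b, c ≤ f x ∧ f x ≤ C) (k : ℕ) :
    c * ((b ^ (k + 1) - a ^ (k + 1)) / (k + 1)) ≤ ∫ x in a..b, f x * x ^ k ∧
      ∫ x in a..b, f x * x ^ k ≤ C * ((b ^ (k + 1) - a ^ (k + 1)) / (k + 1)) := by
  have hconst (d : ℝ) : IntervalIntegrable (fun x => d * x ^ k) volume a b :=
    (by fun_prop : Continuous fun x : ℝ => d * x ^ k).intervalIntegrable a b
  have hfi : IntervalIntegrable f volume a b := by
    rw [intervalIntegrable_iff_integrableOn_Icc_of_le hab]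
    refine Measure.integrableOn_of_bounded (M := max |c| |C|) (by simp)
      hf.aestronglyMeasurable ?_
    filter_upwards [ae_restrict_mem measurableSet_Icc] with x hx
    exact abs_le_max_abs_abs (hbounds x hx).1 (hbounds x hx).2
  have hint : IntervalIntegrable (fun x => f x * x ^ k) volume a b :=
    hfi.mul_continuousOn (by fun_prop)
  simp only [← integral_pow, ← intervalIntegral.integral_const_mul]
  refine ⟨intervalIntegral.integral_mono_on hab (hconst c) hint fun x hx => ?_,
    intervalIntegral.integral_mono_on hab hint (hconst C) fun x hx => ?_⟩
  · exact mul_le_mul_of_nonneg_right (hbounds x hx).1 (pow_nonneg (ha.trans hx.1) k)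
  · exact mul_le_mul_of_nonneg_right (hbounds x hx).2 (pow_nonneg (ha.trans hx.1) k)

/-- **Proposition 4.3.** For a random variable `X` whose law has density `f` supported on
`[1/λ, 1]` with `f_max ≥ f(x) ≥ f_min > 0` there, a dimension `n ≥ 1` and tolerance `ε > 0`:
if the number of samples `N` satisfies
`N ≥ (f_max/f_min²)·((n+1)²/(2n+1))·((1 − 1/λ^{2n+1})/(1 − 1/λ^{n+1})²)·(1/ε²)`,
then the relative RMS error satisfies `(√Var(X^n)/E[X^n])·(1/√N) ≤ ε`.
In particular, the required number of samples grows at most linearly in `n`. -/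
theorem samples_scale_linearly_with_dimension
    {Ω : Type*} [MeasurableSpace Ω] (μ : Measure Ω) [IsProbabilityMeasure μ]
    (lam : ℝ) (hlam : 1 < lam)
    (X : Ω → ℝ) (hX : Measurable X)
    (f : ℝ → ℝ) (hf : Measurable f)
    (hlaw : μ.map X = volume.withDensity fun x => ENNReal.ofReal (f x))
    (hsupp : ∀ x ∉ Set.Icc (1 / lam) 1, f x = 0)
    (fmin fmax : ℝ) (hfmin : 0 < fmin)
    (hbounds : ∀ x ∈ Set.Icc (1 / lam) 1, fmin ≤ f x ∧ f x ≤ fmax)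
    (n : ℕ) (hn : 1 ≤ n) (ε : ℝ) (hε : 0 < ε)
    (N : ℕ)
    (hN : (fmax / fmin ^ 2) * ((n + 1) ^ 2 / (2 * n + 1)) *
        ((1 - 1 / lam ^ (2 * n + 1)) / (1 - 1 / lam ^ (n + 1)) ^ 2) * (1 / ε ^ 2) ≤ N) :
    (Real.sqrt (variance (fun ω => X ω ^ n) μ) / ∫ ω, X ω ^ n ∂μ) *
        (1 / Real.sqrt N) ≤ ε := by
  have hlam0 : 0 < lam := by linarith
  have ha : (0 : ℝ) < 1 / lam := by positivity
  have ha1 : 1 / lam < 1 := by rwa [div_lt_one hlam0]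
  have hf0 (x : ℝ) : 0 ≤ f x := by
    by_cases hx : x ∈ Set.Icc (1 / lam) 1
    · exact hfmin.le.trans (hbounds x hx).1
    · exact (hsupp x hx).ge
  have hfmax : 0 < fmax := by
    have h := hbounds 1 ⟨ha1.le, le_rfl⟩
    linarith
  have hmean : fmin * ((1 - 1 / lam ^ (n + 1)) / (n + 1)) ≤ ∫ ω, X ω ^ n ∂μ := by
    rw [integral_pow_eq_intervalIntegral_density ha1.le hX hf hf0 hlaw hsupp]
    simpa using (intervalIntegral_density_mul_pow_bounds ha.le ha1.le hf hbounds n).1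
  have hvar : variance (fun ω => X ω ^ n) μ ≤
      fmax * ((1 - 1 / lam ^ (2 * n + 1)) / (2 * n + 1)) := by
    refine (variance_le_expectation_sq (by fun_prop)).trans ?_
    simp only [Pi.pow_apply, ← pow_mul, mul_comm n 2]
    rw [integral_pow_eq_intervalIntegral_density ha1.le hX hf hf0 hlaw hsupp]
    simpa using (intervalIntegral_density_mul_pow_bounds ha.le ha1.le hf hbounds (2 * n)).2
  have hpow (k : ℕ) : 0 < 1 - 1 / lam ^ (k + 1) := by
    rw [← one_div_pow, sub_pos]
    exact pow_lt_one₀ ha.le ha1 (by simp)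
  have hp := hpow n
  have hq := hpow (2 * n)
  set p := 1 - 1 / lam ^ (n + 1)
  set q := 1 - 1 / lam ^ (2 * n + 1)
  set m := ∫ ω, X ω ^ n ∂μ
  have hm₀ : 0 < fmin * (p / (n + 1)) := by positivity
  have hm : 0 < m := hm₀.trans_le hmean
  have hN0 : (0 : ℝ) < N := lt_of_lt_of_le (by positivity) hN
  have hkey : variance (fun ω => X ω ^ n) μ ≤ ε ^ 2 * m ^ 2 * N := by
    calc variance (fun ω => X ω ^ n) μ ≤ fmax * (q / (2 * n + 1)) := hvar
      _ = ε ^ 2 * (fmin * (p / (n + 1))) ^ 2 * ((fmax / fmin ^ 2) *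
            ((n + 1) ^ 2 / (2 * n + 1)) * (q / p ^ 2) * (1 / ε ^ 2)) := by
          field_simp
      _ ≤ ε ^ 2 * m ^ 2 * N := by gcongr
  rw [mul_one_div, div_div, div_le_iff₀ (by positivity)]
  refine Real.sqrt_le_iff.2 ⟨by positivity, hkey.trans_eq ?_⟩
  rw [mul_pow, mul_pow, Real.sq_sqrt hN0.le, mul_assoc]
end
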